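/- The highest priority queue of a packetized non-preemptive strict priority server of constant bit rate c offers the service curve β(t) = c·max(t − l^M/c − L/c, 0), where l^M is the maximum packet length of the highest priority queue and L the maximum packet length of all lower priority queues. Concretely: let c > 0, L ≥ 0, let high-priority packets n = 1, 2, ... arrive at times 0 ≤ a(1) ≤ a(2) ≤ ... with lengths 0 < l(n) ≤ l^M, and let departures satisfy d(0) = 0 and d(n) = max(a(n) + w(n), d(n − 1)) + l(n)/c, where w(n) ∈ [0, L/c] and w(n) = 0 whenever a(n) < d(n − 1); let A(t) = Σ_{n : a(n) < t} l(n) and A*(t) = Σ_{n : d(n) < t} l(n). Then for all t ≥ 0, A*(t) ≥ inf_{0 ≤ s ≤ t} { A(s) + c·max(t − s − (l^M + L)/c, 0) }. -/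

import Mathlib

/-- Departure times of a packetized work-conserving FIFO server of constant bit
rate `c`: `d(0) = 0` and `d(n+1) = max(a(n+1), d(n)) + l(n+1)/c`, where `a` gives
the times the packets become available and `len` their lengths.  For a
non-preemptive strict priority server, the availability time of high-priority
packet `n` is `a(n) + w(n)`, where `w(n)` is the residual transmission time of a
lower-priority packet under transmission at its arrival. -/
noncomputable def dep (c : ℝ) (a len : ℕ → ℝ) : ℕ → ℝ
  | 0 => 0
  | n + 1 => max (a (n + 1)) (dep c a len n) + len (n + 1) / c

/-- The `N` packets served by time `dep N` take at least their total transmission time. -/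
theorem sum_len_le_mul_dep {c : ℝ} (hc : 0 < c) (a len : ℕ → ℝ) (hlen0 : len 0 = 0) (N : ℕ) :
    ∑ k ∈ Finset.range (N + 1), len k ≤ c * dep c a len N := by
  induction N with
  | zero => simp [dep, hlen0]
  | succ N ih =>
    rw [Finset.sum_range_succ]
    have h : dep c a len (N + 1) = max (a (N + 1)) (dep c a len N) + len (N + 1) / c := rfl
    have hmax := mul_le_mul_of_nonneg_left (le_max_right (a (N + 1)) (dep c a len N)) hc.le
    rw [h, mul_add, mul_div_cancel₀ _ hc.ne']
    linarith

theorem dep_monotone {c : ℝ} (hc : 0 < c) (a len : ℕ → ℝ) (hlen : ∀ n, 0 ≤ len n) :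
    Monotone (dep c a len) := by
  refine monotone_nat_of_le_succ fun n => ?_
  have h : dep c a len (n + 1) = max (a (n + 1)) (dep c a len n) + len (n + 1) / c := rfl
  have hmax := le_max_right (a (n + 1)) (dep c a len n)
  have hdiv := div_nonneg (hlen (n + 1)) hc.le
  linarith

/-- Every departure is bounded through the first packet `m` of its busy period, whose start of
transmission is delayed by at most `L / c`. -/
theorem exists_busy_period_start {c L : ℝ} (hc : 0 < c) (a w len : ℕ → ℝ) (ha1 : 0 ≤ a 1)
    (hw : ∀ n, 1 ≤ n → 0 ≤ w n ∧ w n ≤ L / c)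
    (hw0 : ∀ n, a (n + 1) < dep c (fun k => a k + w k) len n → w (n + 1) = 0) (N : ℕ) :
    ∃ m, 1 ≤ m ∧ m ≤ N + 1 ∧ c * dep c (fun k => a k + w k) len (N + 1) ≤
      c * a m + L + ∑ k ∈ Finset.Ico m (N + 2), len k := by
  induction N with
  | zero =>
    refine ⟨1, le_rfl, le_rfl, ?_⟩
    obtain ⟨h0, h1⟩ := hw 1 le_rfl
    rw [le_div_iff₀ hc] at h1
    have hmax : max (a 1 + w 1) 0 = a 1 + w 1 := max_eq_left (by linarith)
    simp only [dep, zero_add, hmax, mul_add, mul_div_cancel₀ _ hc.ne', Nat.Ico_succ_singleton,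
      Finset.sum_singleton]
    linarith
  | succ N ih =>
    have h : dep c (fun k => a k + w k) len (N + 2) =
      max (a (N + 2) + w (N + 2)) (dep c (fun k => a k + w k) len (N + 1)) + len (N + 2) / c := rfl
    rcases lt_or_ge (a (N + 2)) (dep c (fun k => a k + w k) len (N + 1)) with hlt | hge
    · obtain ⟨m, hm1, hmN, hm⟩ := ih
      refine ⟨m, hm1, by omega, ?_⟩
      rw [h, hw0 (N + 1) hlt, add_zero, max_eq_right hlt.le, mul_add, mul_div_cancel₀ _ hc.ne',
        Finset.sum_Ico_succ_top (by omega)]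
      linarith
    · obtain ⟨h0, h1⟩ := hw (N + 2) (by omega)
      rw [le_div_iff₀ hc] at h1
      refine ⟨N + 2, by omega, le_rfl, ?_⟩
      rw [h, max_eq_left (by linarith), mul_add, mul_add, mul_div_cancel₀ _ hc.ne',
        Nat.Ico_succ_singleton, Finset.sum_singleton]
      linarith

/-- If the events from `m` on occur no earlier than `t`, the work counted before `t` is at most
that of the first `m` packets. -/
theorem tsum_ite_lt_le_sum_range {f len : ℕ → ℝ} (hlen : ∀ n, 0 ≤ len n) {t : ℝ} {m : ℕ}
    (hf : ∀ n, m ≤ n → t ≤ f n) :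
    (∑' n, if f n < t then len n else 0) ≤ ∑ n ∈ Finset.range m, len n := by
  rw [tsum_eq_sum (s := Finset.range m)]
  · refine Finset.sum_le_sum fun n _ => ?_
    split_ifs
    exacts [le_rfl, hlen n]
  · intro n hn
    exact if_neg (hf n (by simpa using hn)).not_gt

/-- The highest priority queue of a packetized non-preemptive
strict priority server of constant bit rate `c` offers the service curve
`β(t) = c·(t − l^M/c − L/c)⁺`: with departures
`d(n) = max(a(n) + w(n), d(n−1)) + l(n)/c`, `w(n) ∈ [0, L/c]`, `w(n) = 0`
whenever `a(n) < d(n−1)`, for all `t ≥ 0`,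
`A*(t) ≥ inf_{0 ≤ s ≤ t} ( A(s) + c·max(t − s − (l^M + L)/c, 0) )`. -/
theorem corrected_service_curve_SP
    (c L lM : ℝ) (hc : 0 < c) (hL : 0 ≤ L)
    (a w len : ℕ → ℝ)
    (ha1 : 0 ≤ a 1) (hamono : ∀ n, 1 ≤ n → a n ≤ a (n + 1))
    (hlen0 : len 0 = 0)
    (hlen : ∀ n, 1 ≤ n → 0 < len n ∧ len n ≤ lM)
    (hw : ∀ n, 1 ≤ n → 0 ≤ w n ∧ w n ≤ L / c)
    (hw0 : ∀ n, a (n + 1) < dep c (fun k => a k + w k) len n → w (n + 1) = 0)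
    (A Astar : ℝ → ℝ)
    (hA : ∀ t, A t = ∑' n : ℕ, if a n < t then len n else 0)
    (hAstar : ∀ t, Astar t =
      ∑' n : ℕ, if dep c (fun k => a k + w k) len n < t then len n else 0) :
    ∀ t, 0 ≤ t →
      sInf ((fun s => A s + c * max (t - s - (lM + L) / c) 0) '' Set.Icc 0 t)
        ≤ Astar t := by
  have hlen' : ∀ n, 0 ≤ len n := fun n => by
    rcases Nat.eq_zero_or_pos n with rfl | hn
    exacts [hlen0.ge, (hlen n hn).1.le]
  have hlM : 0 < lM := (hlen 1 le_rfl).1.trans_le (hlen 1 le_rfl).2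
  have ha : ∀ m n, 1 ≤ m → m ≤ n → a m ≤ a n := fun m n hm hmn => by
    induction n, hmn using Nat.le_induction with
    | base => exact le_rfl
    | succ n hmn ih => exact ih.trans (hamono n (hm.trans hmn))
  have hA0 : ∀ s, 0 ≤ A s := fun s => by
    rw [hA]
    exact tsum_nonneg fun n => by split_ifs; exacts [hlen' n, le_rfl]
  have hA_le : ∀ s m, 1 ≤ m → s ≤ a m → A s ≤ ∑ n ∈ Finset.range m, len n := fun s m hm hs => by
    rw [hA]
    exact tsum_ite_lt_le_sum_range hlen' fun n hn => hs.trans (ha m n hm hn)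
  intro t ht
  suffices h : ∃ s ∈ Set.Icc 0 t, A s + c * max (t - s - (lM + L) / c) 0 ≤ Astar t by
    obtain ⟨s, hs, hle⟩ := h
    refine csInf_le_of_le ⟨0, ?_⟩ ⟨s, hs, rfl⟩ hle
    rintro _ ⟨r, -, rfl⟩
    exact add_nonneg (hA0 r) (mul_nonneg hc.le (le_max_right _ _))
  have hfinish : A t ≤ Astar t →
      ∃ s ∈ Set.Icc 0 t, A s + c * max (t - s - (lM + L) / c) 0 ≤ Astar t := fun h => by
    refine ⟨t, ⟨ht, le_rfl⟩, ?_⟩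
    have hdiv : 0 ≤ (lM + L) / c := by positivity
    rw [max_eq_right (by linarith), mul_zero, add_zero]
    exact h
  set d := dep c (fun k => a k + w k) len with hd
  have hdmono : Monotone d := dep_monotone hc _ len hlen'
  by_cases hall : ∀ n, d n < t
  · apply hfinish
    have hsum : Summable len := by
      refine summable_of_sum_range_le (c := c * t) hlen' fun n => ?_
      have hsucc : ∑ k ∈ Finset.range n, len k ≤ ∑ k ∈ Finset.range (n + 1), len k := by
        rw [Finset.sum_range_succ]
        exact le_add_of_nonneg_right (hlen' n)
      exact hsucc.trans ((sum_len_le_mul_dep hc _ len hlen0 n).trans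
        (mul_le_mul_of_nonneg_left (hall n).le hc.le))
    have hle : ∀ n, (if a n < t then len n else 0) ≤ len n := fun n => by
      split_ifs
      exacts [le_rfl, hlen' n]
    have hnonneg : ∀ n, 0 ≤ if a n < t then len n else 0 := fun n => by
      split_ifs
      exacts [hlen' n, le_rfl]
    rw [hA, hAstar]
    simp only [hall, if_true]
    exact (Summable.of_nonneg_of_le hnonneg hle hsum).tsum_le_tsum hle hsum
  · push Not at hall
    classical
    obtain ⟨N, hN, hNmin⟩ : ∃ N, t ≤ d N ∧ ∀ n < N, d n < t :=
      ⟨Nat.find hall, Nat.find_spec hall, fun n hn => not_le.1 (Nat.find_min hall hn)⟩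
    have hAstar_eq : Astar t = ∑ n ∈ Finset.range N, len n := by
      rw [hAstar, tsum_eq_sum (s := Finset.range N)]
      · exact Finset.sum_congr rfl fun n hn => if_pos (hNmin n (Finset.mem_range.1 hn))
      · intro n hn
        exact if_neg (hN.trans (hdmono (by simpa using hn))).not_gt
    rcases N with _ | N
    · apply hfinish
      have ht0 : t ≤ a 1 := hN.trans ha1
      have := hA_le t 1 le_rfl ht0
      simpa [hAstar_eq, hlen0] using this
    rcases le_or_gt t (a (N + 1)) with hta | hta
    · exact hfinish (hAstar_eq ▸ hA_le t (N + 1) (by omega) hta)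
    obtain ⟨m, hm1, hmN, hm⟩ := exists_busy_period_start hc a w len ha1 hw hw0 N
    refine ⟨a m, ⟨ha1.trans (ha 1 m le_rfl hm1), (ha m _ hm1 hmN).trans hta.le⟩, ?_⟩
    rw [Finset.sum_Ico_succ_top hmN] at hm
    have hsplit := Finset.sum_range_add_sum_Ico len hmN
    have hlast := (hlen (N + 1) (by omega)).2
    have htd := mul_le_mul_of_nonneg_left hN hc.le
    have hbacklog : c * max (t - a m - (lM + L) / c) 0 ≤ ∑ k ∈ Finset.Ico m (N + 1), len k := by
      rw [mul_max_of_nonneg _ _ hc.le, mul_zero, mul_sub, mul_sub, mul_div_cancel₀ _ hc.ne']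
      exact max_le (by linarith) (Finset.sum_nonneg fun n _ => hlen' n)
    linarith [hA_le (a m) m hm1 le_rfl]
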